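/- Fix n ≥ 1 and c ∈ [0,1) with cn ∈ ℕ. Let P ∈ (ℝ²)ⁿ be a profile, ô ∈ ℝ² a prediction, o a minimizer of C^u(·, P), i an agent, and p'_i = p_i + t(o − p_i) for some t ∈ (0,1] (so p'_i lies on the segment from p_i to o, strictly closer to o). Let Q = (P_{−i}, p'_i). If CMP(Q, ô, c) = CMP(P, ô, c) and r(P, ô, c) > 1, then r(Q, ô, c) > r(P, ô, c), where r(R, ô, c) = C^u(CMP(R, ô, c), R) / OPT^u(R). -/

import Mathlib

/-- Euclidean distance on the plane. -/
noncomputable def eudist (a b : ℝ × ℝ) : ℝ :=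
  Real.sqrt ((a.1 - b.1) ^ 2 + (a.2 - b.2) ^ 2)

/-- Utilitarian social cost: the average distance from `y` to the points of `P`. -/
noncomputable def Cu {n : ℕ} (y : ℝ × ℝ) (P : Fin n → ℝ × ℝ) : ℝ :=
  (∑ i, eudist y (P i)) / n

/-- The lower median of a multiset of `m` reals: its `⌈m/2⌉`-th smallest element. -/
noncomputable def lowerMedian (s : Multiset ℝ) : ℝ :=
  (s.sort (· ≤ ·)).getD ((s.card + 1) / 2 - 1) 0

/-- The Coordinatewise Median with Predictions mechanism: the coordinatewise
lower median of the reported points together with `k` copies of the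
prediction (where `k = c·n` for confidence `c`). -/
noncomputable def CMP {n : ℕ} (P : Fin n → ℝ × ℝ) (oh : ℝ × ℝ) (k : ℕ) : ℝ × ℝ :=
  (lowerMedian ((↑(List.ofFn fun i => (P i).1) : Multiset ℝ) + Multiset.replicate k oh.1),
   lowerMedian ((↑(List.ofFn fun i => (P i).2) : Multiset ℝ) + Multiset.replicate k oh.2))

theorem eudist_eq_dist (a b : ℝ × ℝ) :
    eudist a b = dist (⟨a.1, a.2⟩ : ℂ) ⟨b.1, b.2⟩ := by
  rw [Complex.dist_eq_re_im]; rfl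

theorem eudist_nonneg (a b : ℝ × ℝ) : 0 ≤ eudist a b := Real.sqrt_nonneg _

theorem eudist_comm (a b : ℝ × ℝ) : eudist a b = eudist b a := by
  simp only [eudist_eq_dist, dist_comm]

theorem eudist_triangle (a b c : ℝ × ℝ) : eudist a c ≤ eudist a b + eudist b c := by
  simp only [eudist_eq_dist]
  exact dist_triangle _ _ _

theorem eq_of_eudist_eq_zero {a b : ℝ × ℝ} (h : eudist a b = 0) : a = b := by
  rw [eudist_eq_dist, dist_eq_zero, Complex.mk.injEq] at h
  exact Prod.ext h.1 h.2

theorem eudist_add_smul_sub_right (o p : ℝ × ℝ) {t : ℝ} (ht : t ≤ 1) :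
    eudist o (p + t • (o - p)) = (1 - t) * eudist o p := by
  have h : (o.1 - (p + t • (o - p)).1) ^ 2 + (o.2 - (p + t • (o - p)).2) ^ 2
      = (1 - t) ^ 2 * ((o.1 - p.1) ^ 2 + (o.2 - p.2) ^ 2) := by
    simp only [Prod.fst_add, Prod.snd_add, Prod.smul_fst, Prod.smul_snd, Prod.fst_sub,
      Prod.snd_sub, smul_eq_mul]
    ring
  rw [eudist, h, Real.sqrt_mul (sq_nonneg _), Real.sqrt_sq (by linarith), eudist]

theorem eudist_add_smul_sub_left (o p : ℝ × ℝ) {t : ℝ} (ht : 0 ≤ t) :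
    eudist (p + t • (o - p)) p = t * eudist o p := by
  have h : ((p + t • (o - p)).1 - p.1) ^ 2 + ((p + t • (o - p)).2 - p.2) ^ 2
      = t ^ 2 * ((o.1 - p.1) ^ 2 + (o.2 - p.2) ^ 2) := by
    simp only [Prod.fst_add, Prod.snd_add, Prod.smul_fst, Prod.smul_snd, Prod.fst_sub,
      Prod.snd_sub, smul_eq_mul]
    ring
  rw [eudist, h, Real.sqrt_mul (sq_nonneg _), Real.sqrt_sq ht, eudist]

theorem Cu_update {n : ℕ} (y : ℝ × ℝ) (P : Fin n → ℝ × ℝ) (i : Fin n) (q : ℝ × ℝ) :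
    Cu y (Function.update P i q) = Cu y P + (eudist y q - eudist y (P i)) / n := by
  have h : ∑ j, eudist y (Function.update P i q j)
      = ∑ j, eudist y (P j) + (eudist y q - eudist y (P i)) := by
    rw [← Finset.add_sum_erase _ _ (Finset.mem_univ i),
      ← Finset.add_sum_erase _ (fun j => eudist y (P j)) (Finset.mem_univ i),
      Finset.sum_congr rfl fun j hj => by
        rw [Function.update_of_ne (Finset.ne_of_mem_erase hj)]]
    simp only [Function.update_self]
    ring
  rw [Cu, h, add_div, Cu]

theorem Cu_nonneg {n : ℕ} (y : ℝ × ℝ) (P : Fin n → ℝ × ℝ) : 0 ≤ Cu y P :=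
  div_nonneg (Finset.sum_nonneg fun _ _ => eudist_nonneg _ _) n.cast_nonneg

theorem eq_of_Cu_eq_zero {n : ℕ} (hn : 1 ≤ n) {y : ℝ × ℝ} {P : Fin n → ℝ × ℝ}
    (h : Cu y P = 0) (j : Fin n) : P j = y := by
  have hn' : (n : ℝ) ≠ 0 := by positivity
  rw [Cu, div_eq_zero_iff, or_iff_left hn',
    Finset.sum_eq_zero_iff_of_nonneg fun _ _ => eudist_nonneg _ _] at h
  exact (eq_of_eudist_eq_zero (h j (Finset.mem_univ j))).symm

theorem iInf_Cu_eq {n : ℕ} {P : Fin n → ℝ × ℝ} {o : ℝ × ℝ} (ho : ∀ y, Cu o P ≤ Cu y P) :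
    ⨅ y, Cu y P = Cu o P :=
  le_antisymm (ciInf_le ⟨0, Set.forall_mem_range.2 fun y => Cu_nonneg y P⟩ o) (le_ciInf ho)

theorem lowerMedian_coe_of_pairwise {l : List ℝ} (hl : l.Pairwise (· ≤ ·)) :
    lowerMedian l = l.getD ((l.length + 1) / 2 - 1) 0 := by
  have h : (l : Multiset ℝ).sort (· ≤ ·) = l :=
    List.Perm.eq_of_pairwise' (Multiset.pairwise_sort _ _) hl
      (Multiset.coe_eq_coe.1 (Multiset.sort_eq _ _))
  rw [lowerMedian, h, Multiset.coe_card]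

theorem lowerMedian_replicate_add_replicate {n k : ℕ} (hk : k < n) (a b : ℝ) :
    lowerMedian (Multiset.replicate n a + Multiset.replicate k b) = a := by
  rcases le_total a b with hab | hab
  · rw [← Multiset.coe_replicate, ← Multiset.coe_replicate, Multiset.coe_add,
      lowerMedian_coe_of_pairwise, List.getD_append _ _ _ _ (by simp; omega),
      List.getD_eq_getElem _ _ (by simp; omega), List.getElem_replicate]
    simp only [List.pairwise_append, List.pairwise_replicate, List.mem_replicate]
    exact ⟨.inr le_rfl, .inr le_rfl, fun x hx y hy => hx.2 ▸ hy.2 ▸ hab⟩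
  · rw [add_comm, ← Multiset.coe_replicate, ← Multiset.coe_replicate, Multiset.coe_add,
      lowerMedian_coe_of_pairwise, List.getD_append_right _ _ _ _ (by simp; omega),
      List.getD_eq_getElem _ _ (by simp; omega), List.getElem_replicate]
    simp only [List.pairwise_append, List.pairwise_replicate, List.mem_replicate]
    exact ⟨.inr le_rfl, .inr le_rfl, fun x hx y hy => hx.2 ▸ hy.2 ▸ hab⟩

theorem CMP_const {n k : ℕ} (hk : k < n) {P : Fin n → ℝ × ℝ} {o : ℝ × ℝ} (hP : ∀ j, P j = o)
    (oh : ℝ × ℝ) : CMP P oh k = o := by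
  simp only [CMP, hP, List.ofFn_const, Multiset.coe_replicate,
    lowerMedian_replicate_add_replicate hk]

/-- moving a point towards the optimal location strictly worsens
the approximation ratio of CMP, provided the mechanism output does not change
and the ratio exceeds 1. -/
theorem CMP_move_towards_opt (n : ℕ) (hn : 1 ≤ n) (c : ℝ) (hc0 : 0 ≤ c) (hc1 : c < 1)
    (k : ℕ) (hk : (k : ℝ) = c * n)
    (P : Fin n → ℝ × ℝ) (oh o : ℝ × ℝ) (ho : ∀ y : ℝ × ℝ, Cu o P ≤ Cu y P)
    (i : Fin n) (hio : P i ≠ o) (t : ℝ) (ht0 : 0 < t) (ht1 : t ≤ 1)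
    (Q : Fin n → ℝ × ℝ) (hQ : Q = Function.update P i (P i + t • (o - P i)))
    (hsame : CMP Q oh k = CMP P oh k)
    (hr : 1 < Cu (CMP P oh k) P / ⨅ y : ℝ × ℝ, Cu y P) :
    Cu (CMP P oh k) P / (⨅ y : ℝ × ℝ, Cu y P) <
      Cu (CMP Q oh k) Q / ⨅ y : ℝ × ℝ, Cu y Q := by
  have hn0 : (0 : ℝ) < n := by exact_mod_cast hn
  have hkn : k < n := by
    have : (k : ℝ) < n := by rw [hk]; nlinarith
    exact_mod_cast this
  have hd : 0 < eudist o (P i) :=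
    (eudist_nonneg _ _).lt_of_ne fun h => hio (eq_of_eudist_eq_zero h.symm).symm
  set δ : ℝ := t * eudist o (P i) / n with hδ
  have hδ0 : 0 < δ := by positivity
  have hQo : Cu o Q = Cu o P - δ := by
    rw [hQ, Cu_update, eudist_add_smul_sub_right o (P i) ht1, hδ]
    ring
  have hQy (y : ℝ × ℝ) : Cu y P - δ ≤ Cu y Q := by
    have h := eudist_triangle y (P i + t • (o - P i)) (P i)
    rw [eudist_add_smul_sub_left o (P i) ht0.le] at h
    rw [hQ, Cu_update, sub_eq_add_neg, hδ, ← neg_div]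
    gcongr
    linarith
  have hoQ (y : ℝ × ℝ) : Cu o Q ≤ Cu y Q := by linarith [hQy y, ho y]
  rw [iInf_Cu_eq ho] at hr ⊢
  rw [iInf_Cu_eq hoQ, hsame]
  have hBP : 0 < Cu o P := by linarith [Cu_nonneg o Q]
  rw [one_lt_div hBP] at hr
  have hBQ : 0 < Cu o Q := by
    refine (Cu_nonneg _ _).lt_of_ne fun h => ?_
    rw [← hsame, CMP_const hkn (eq_of_Cu_eq_zero hn h.symm)] at hr
    exact lt_irrefl _ hr
  rw [div_lt_div_iff₀ hBP hBQ]
  nlinarith [hQy (CMP P oh k), mul_le_mul_of_nonneg_right (hQy (CMP P oh k)) hBP.le,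
    mul_lt_mul_of_pos_left hr hδ0]
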